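/- Let (R, m, k) be a Noetherian local ring with infinite residue field k and m² ≠ 0, and let r ≥ 1 be an integer. If μ(m²) < (r+2 choose 2), then ms(R) ≤ r. In particular, if μ(m²) ≤ 2, then ms(R) = 1. -/

import Mathlib

open IsLocalRing

/-- The minimal number of generators of an ideal. -/
noncomputable def mu {R : Type*} [CommRing R] (I : Ideal R) : ℕ :=
  sInf {n : ℕ | ∃ s : Finset R, s.card = n ∧ Ideal.span (s : Set R) = I}

/-- `ms R = min {μ(I) : m² ⊆ I ⊆ m}`. -/
noncomputable def ms (R : Type*) [CommRing R] [IsLocalRing R] : ℕ :=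
  sInf {n : ℕ | ∃ I : Ideal R,
    (maximalIdeal R) ^ 2 ≤ I ∧ I ≤ maximalIdeal R ∧ mu I = n}


section ES
open Module

theorem es_li {k W ι : Type*} [Field k] [AddCommGroup W] [Module k W] [Finite ι]
    (a b : ι → W) (ha : LinearIndependent k a) :
    {t : k | ¬ LinearIndependent k (fun i => a i + t • b i)}.Finite := by
  classical
  cases nonempty_fintype ι
  obtain ⟨g, hg⟩ := (Fintype.linearCombination k a).exists_leftInverse_of_injective
    (by rw [LinearMap.ker_eq_bot]; exact ha.fintypeLinearCombination_injective)
  let M : Matrix ι ι k := Matrix.of fun i j => g (b i) j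
  let p : Polynomial k := Matrix.det (1 + (Polynomial.X : Polynomial k) • M.map Polynomial.C)
  have hp : ∀ t, p.eval t = Matrix.det (1 + t • M) := by
    intro t
    change (Polynomial.evalRingHom t) p = _
    simp only [p]
    rw [RingHom.map_det]
    congr 1
    ext i j
    simp [Matrix.one_apply, apply_ite]
    ring
  have hp0 : p ≠ 0 := by
    intro h
    have := hp 0
    simp [h] at this
  refine (p.roots.toFinset.finite_toSet).subset ?_
  intro t ht
  simp only [Finset.mem_coe, Multiset.mem_toFinset, Polynomial.mem_roots hp0, Polynomial.IsRoot]
  by_contra hne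
  apply ht
  rw [hp] at hne
  have h1 : LinearIndependent k (1 + t • M).row :=
    Matrix.linearIndependent_rows_of_det_ne_zero hne
  refine LinearIndependent.of_comp g ?_
  have h5 : (g ∘ fun i => a i + t • b i) = (1 + t • M).row := ?_
  · rw [h5]; exact h1
  ext i j
  have := congrArg (fun f => f (Pi.single i 1) j) hg
  simp [Fintype.linearCombination_apply_single] at this
  simp [M, this, Matrix.row, Matrix.one_apply, Pi.single_apply, eq_comm]

theorem es_single {k V : Type*} [Field k] [AddCommGroup V] [Module k V] (y : V) :
    finrank k (k ∙ y) ≤ 1 := by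
  simpa using finrank_span_le_card (R := k) ({y} : Set V)

theorem es_rank {k V W : Type*} [Field k] [AddCommGroup W] [Module k W]
    [AddCommGroup V] [Module k V] [FiniteDimensional k W]
    {n : ℕ} (L : V →ₗ[k] W) (v : Fin n → V) (h : LinearIndependent k (fun i => L (v i))) :
    n ≤ finrank k L.range := by
  have : LinearIndependent k (fun i => (⟨L (v i), v i, rfl⟩ : L.range)) :=
    LinearIndependent.of_comp L.range.subtype h
  simpa using this.fintype_card_le_finrank

theorem es_basis {k V W : Type*} [Field k] [AddCommGroup W] [Module k W]
    [AddCommGroup V] [Module k V] [FiniteDimensional k W]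
    (L : V →ₗ[k] W) : ∃ v : Fin (finrank k L.range) → V, 
      LinearIndependent k (fun i => L (v i)) := by
  let b := finBasis k L.range
  choose v hv using fun i => (b i).2
  refine ⟨v, ?_⟩
  have := b.linearIndependent.map' L.range.subtype (Submodule.ker_subtype _)
  have h5 : (fun i => L (v i)) = L.range.subtype ∘ b := funext hv
  rw [h5]; exact this

/-- semicontinuity -/
theorem es_semi {k V W : Type*} [Field k] [AddCommGroup W] [Module k W]
    [AddCommGroup V] [Module k V] [FiniteDimensional k W] (L M : V →ₗ[k] W) :
    {t : k | ¬ finrank k L.range ≤ finrank k (L + t • M).range}.Finite := by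
  obtain ⟨v, hv⟩ := es_basis L
  refine (es_li _ (fun i => M (v i)) hv).subset ?_
  intro t ht h
  exact ht (es_rank (L + t • M) v h)

theorem es_pert {k V W : Type*} [Field k] [Infinite k] [AddCommGroup W] [Module k W]
    [AddCommGroup V] [Module k V] [FiniteDimensional k W] (L M : V →ₗ[k] W)
    (hmax : ∀ t : k, finrank k (L + t • M).range ≤ finrank k L.range)
    (u : V) (hu : L u = 0) : M u ∈ L.range := by
  by_contra hn
  obtain ⟨v, hv⟩ := es_basis L
  have h2 : LinearIndependent k (Fin.cons (M u) (fun i => L (v i)) : Fin _ → W) := by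
    rw [linearIndependent_finCons]
    refine ⟨hv, fun h => hn ?_⟩
    refine (Submodule.span_le.2 ?_) h
    rintro _ ⟨i, rfl⟩
    exact ⟨v i, rfl⟩
  have hf := es_li _ (Fin.cons 0 (fun i => M (v i))) h2
  obtain ⟨t, ht⟩ := (hf.union (Set.finite_singleton 0)).exists_notMem
  simp only [Set.mem_union, Set.mem_ofPred_eq, Set.mem_singleton_iff, not_or, not_not] at ht
  obtain ⟨h3, ht0⟩ := ht
  have := es_rank (L + t • M) (Fin.cons (t⁻¹ • u) v : Fin (_ + 1) → V) (by
    convert h3 using 1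
    ext i
    refine Fin.cases ?_ (fun j => ?_) i
    · simp [hu, smul_smul, ht0]
    · simp)
  have := hmax t
  omega

theorem es_main {k V : Type*} [Field k] [Infinite k] [AddCommGroup V] [Module k V]
    [FiniteDimensional k V] (r : ℕ) : ∀ {W : Type*} [AddCommGroup W] [Module k W]
    [FiniteDimensional k W] (B : V →ₗ[k] V →ₗ[k] W) (hs : ∀ x y, B x y = B y x)
    (hB : Submodule.map₂ B ⊤ ⊤ = ⊤) (hd : finrank k W < (r + 2).choose 2),
    ∃ U : Submodule k V, finrank k U ≤ r ∧ Submodule.map₂ B U ⊤ = ⊤ := by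
  induction r with
  | zero =>
    intro W _ _ _ B hs hB hd
    have : finrank k W = 0 := by simpa using hd
    have := finrank_zero_iff.1 this
    exact ⟨⊥, by simp, Subsingleton.elim _ _⟩
  | succ r ih =>
    intro W _ _ _ B hs hB hd
    by_cases hc : ∃ y, r + 2 ≤ finrank k (B y).range
    · obtain ⟨y, hy⟩ := hc
      have h1 := (B y).range.finrank_quotient_add_finrank
      have h2 : (r + 1 + 2).choose 2 = (r + 2).choose 2 + (r + 2) := by
        rw [Nat.choose_succ_succ (r+2) 1]; simp; ring
      obtain ⟨U, hU, hU2⟩ := ih (B.compr₂ (B y).range.mkQ) (by intro x z; simp [hs x z])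
        (by rw [← Submodule.map_map₂, hB]; simp) (by omega)
      refine ⟨U ⊔ k ∙ y, ?_, ?_⟩
      · have := Submodule.finrank_add_le_finrank_add_finrank U (k ∙ y)
        have := es_single (k := k) y
        omega
      · rw [← Submodule.map_map₂] at hU2
        rw [eq_top_iff]
        intro w _
        have : (B y).range.mkQ w ∈ Submodule.map (B y).range.mkQ (Submodule.map₂ B U ⊤) := by
          rw [hU2]; trivial
        obtain ⟨w', hw', e⟩ := this
        have e2 : w - w' ∈ (B y).range := by
          rw [← Submodule.ker_mkQ (B y).range, LinearMap.mem_ker, map_sub, e, sub_self]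
        obtain ⟨x, hx⟩ := e2
        have : w = w' + B y x := by rw [hx]; abel
        rw [this]
        refine add_mem (Submodule.map₂_le_map₂_left le_sup_left hw') ?_
        exact Submodule.apply_mem_map₂ _ 
          (le_sup_right (a := U) (Submodule.mem_span_singleton_self y)) trivial
    · push Not at hc
      obtain ⟨y, hy⟩ : ∃ y, ∀ z, finrank k (B z).range ≤ finrank k (B y).range := by
        have hbd : (Set.range fun y => finrank k (B y).range).Finite :=
          (Set.finite_Iio (r+2)).subset (by rintro _ ⟨y, rfl⟩; exact hc y)
        obtain ⟨_, ⟨y, rfl⟩, h⟩ := Set.exists_max_image _ id hbd ⟨_, 0, rfl⟩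
        exact ⟨y, fun z => h _ ⟨z, rfl⟩⟩
      have hK : ∀ y, (∀ z, finrank k (B z).range ≤ finrank k (B y).range) →
          ∀ u ∈ LinearMap.ker (B y), ∀ z, B u z ∈ (B y).range := by
        intro y hy u hu z
        rw [hs]
        refine es_pert (B y) (B z) (fun t => ?_) u hu
        rw [← map_smul, ← map_add]; exact hy _
      by_cases hsq : ∃ y, (∀ z, finrank k (B z).range ≤ finrank k (B y).range) ∧ B y y ≠ 0
      · obtain ⟨y, hy, hyy⟩ := hsq
        have hdis : Disjoint (LinearMap.ker (B y)) (k ∙ y) := by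
          rw [Submodule.disjoint_span_singleton']
          · exact hyy
          · rintro rfl; simp at hyy
        obtain ⟨C, hyC, hC⟩ := hdis.symm.exists_isCompl
        replace hyC : y ∈ C := hyC (Submodule.mem_span_singleton_self y)
        replace hC : IsCompl (LinearMap.ker (B y)) C := hC.symm
        refine ⟨C, ?_, ?_⟩
        · have h1 := Submodule.finrank_add_eq_of_isCompl hC
          have h2 := (B y).finrank_range_add_finrank_ker
          have := hc y
          omega
        · rw [eq_top_iff, ← hB, Submodule.map₂_le]
          intro v _ w _
          obtain ⟨u, hu, c, hcC, rfl⟩ := Submodule.mem_sup.1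
            (show v ∈ LinearMap.ker (B y) ⊔ C by rw [hC.sup_eq_top]; trivial)
          rw [map_add, LinearMap.add_apply]
          obtain ⟨x, hx⟩ := hK y hy u hu w
          rw [← hx]
          exact add_mem (Submodule.apply_mem_map₂ _ hyC trivial)
            (Submodule.apply_mem_map₂ _ hcC trivial)
      · push Not at hsq
        have halt : ∀ z, B z z = 0 := by
          intro z
          have hf := (es_semi (B y) (B z)).union (Set.finite_singleton 0)
          obtain ⟨t, ht⟩ := hf.exists_notMem
          obtain ⟨s, hs'⟩ := (hf.union (Set.finite_singleton t)).exists_notMem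
          simp only [Set.mem_union, Set.mem_ofPred_eq, Set.mem_singleton_iff, not_or, not_not]
            at ht hs'
          have key : ∀ t : k, finrank k (B y).range ≤ finrank k (B y + t • B z).range →
              t ≠ 0 → t • B z z + (2:k) • B y z = 0 := by
            intro t h1 h0
            rw [← map_smul, ← map_add] at h1
            have h2 := hsq (y + t • z) (fun z => (hy z).trans h1)
            have h3 := hsq y hy
            simp only [map_add, map_smul, LinearMap.add_apply, LinearMap.smul_apply, h3, 
              hs z y] at h2
            have h4 : t • (t • B z z + (2:k) • B y z) = 0 := by
              rw [← h2]; module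
            exact (smul_eq_zero.1 h4).resolve_left h0
          have e1 := key t ht.1 ht.2
          have e2 := key s hs'.1.1 hs'.1.2
          have : (s - t) • B z z = 0 := by
            have : (s - t) • B z z = (s • B z z + (2:k) • B y z) - (t • B z z + (2:k) • B y z) := by
              module
            rw [this, e1, e2, sub_zero]
          exact (smul_eq_zero.1 this).resolve_left (sub_ne_zero.2 hs'.2)
        obtain ⟨C, hC⟩ := exists_isCompl (LinearMap.ker (B y))
        have h1 := Submodule.finrank_add_eq_of_isCompl hC
        have h2 := (B y).finrank_range_add_finrank_ker
        have h3 := hc y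
        obtain ⟨C', c, hC', hCC⟩ : ∃ (C' : Submodule k V) (c : V), finrank k C' ≤ r ∧
            C ≤ C' ⊔ k ∙ c := by
          let b := finBasis k C
          by_cases h0 : finrank k C = 0
          · exact ⟨⊥, 0, by simp, by rw [Submodule.finrank_eq_zero.1 h0]; simp⟩
          · obtain ⟨n, hn⟩ := Nat.exists_eq_succ_of_ne_zero h0
            let b := finBasisOfFinrankEq k C hn
            refine ⟨Submodule.span k (Set.range fun i : Fin n => (b i.succ : V)), b 0, ?_, ?_⟩
            · have := finrank_range_le_card (R := k) (fun i : Fin n => (b i.succ : V))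
              simp [Set.finrank] at this
              omega
            · intro x hx
              have := congrArg (Subtype.val) (b.sum_repr ⟨x, hx⟩)
              rw [Fin.sum_univ_succ] at this
              simp only [Submodule.coe_add, Submodule.coe_smul, Submodule.coe_sum] at this
              rw [← this, add_comm]
              refine Submodule.add_mem_sup (Submodule.sum_mem _ fun i _ => 
                Submodule.smul_mem _ _ (Submodule.subset_span ⟨i, rfl⟩)) 
                (Submodule.smul_mem _ _ (Submodule.mem_span_singleton_self _))
        refine ⟨C' ⊔ k ∙ y, ?_, ?_⟩
        · have := Submodule.finrank_add_le_finrank_add_finrank C' (k ∙ y)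
          have := es_single (k := k) y
          omega
        · rw [eq_top_iff, ← hB, Submodule.map₂_le]
          set N := Submodule.map₂ B (C' ⊔ k ∙ y) ⊤ with hN
          have hyN : ∀ x, B y x ∈ N := fun x => Submodule.apply_mem_map₂ _ 
            (le_sup_right (a := C') (Submodule.mem_span_singleton_self y)) trivial
          have hKN : ∀ u ∈ LinearMap.ker (B y), ∀ z, B u z ∈ N := by
            intro u hu z
            obtain ⟨x, hx⟩ := hK y hy u hu z
            rw [← hx]; exact hyN x
          have hCN : ∀ u ∈ C', ∀ z, B u z ∈ N := fun u hu z => Submodule.apply_mem_map₂ _ 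
            (le_sup_left (b := k ∙ y) hu) trivial
          have dec : ∀ v, ∃ u, (∀ z, B u z ∈ N) ∧ ∃ a : k, v = u + a • c := by
            intro v
            obtain ⟨u, hu, d, hd, rfl⟩ := Submodule.mem_sup.1
              (show v ∈ LinearMap.ker (B y) ⊔ C by rw [hC.sup_eq_top]; trivial)
            obtain ⟨d', hd', e, he, rfl⟩ := Submodule.mem_sup.1 (hCC hd)
            obtain ⟨a, rfl⟩ := Submodule.mem_span_singleton.1 he
            refine ⟨u + d', fun z => ?_, a, by abel⟩
            rw [map_add, LinearMap.add_apply]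
            exact add_mem (hKN u hu z) (hCN d' hd' z)
          intro v _ w _
          obtain ⟨u, hu, a, rfl⟩ := dec v
          obtain ⟨u', hu', b, rfl⟩ := dec w
          have : B (u + a • c) (u' + b • c) = B u (u' + b • c) + a • B u' c + (a * b) • B c c := by
            simp only [map_add, map_smul, LinearMap.add_apply, LinearMap.smul_apply, hs c u']
            module
          rw [this, halt c, smul_zero, add_zero]
          exact add_mem (hu _) (N.smul_mem _ (hu' _))

theorem mu_le_card {R : Type*} [CommRing R] (s : Finset R) :
    mu (Ideal.span (s : Set R)) ≤ s.card := Nat.sInf_le ⟨s, rfl, rfl⟩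

theorem mu_spec {R : Type*} [CommRing R] [IsNoetherianRing R] (I : Ideal R) :
    ∃ s : Finset R, s.card = mu I ∧ Ideal.span (s : Set R) = I := by
  have : {n : ℕ | ∃ s : Finset R, s.card = n ∧ Ideal.span (s : Set R) = I}.Nonempty := by
    obtain ⟨s, hs⟩ := (isNoetherianRing_iff_ideal_fg R).1 inferInstance I
    exact ⟨_, s, rfl, hs⟩
  exact Nat.sInf_mem this

theorem es_alg {R W : Type*} [CommRing R] [IsLocalRing R] [IsNoetherianRing R]
    [Infinite (ResidueField R)] [AddCommGroup W] [Module R W] [Module (ResidueField R) W]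
    [IsScalarTower R (ResidueField R) W]
    (q : ↥((maximalIdeal R) ^ 2) →ₗ[R] W) (hq : Function.Surjective q)
    (hker : LinearMap.ker q = maximalIdeal R • ⊤) (r : ℕ)
    (hd : mu ((maximalIdeal R) ^ 2) < (r + 2).choose 2) :
    ∃ I : Ideal R, (maximalIdeal R) ^ 2 ≤ I ∧ I ≤ maximalIdeal R ∧ mu I ≤ r := by
  classical
  -- R-submodules are k-submodules
  have hsm : ∀ (a : R) (w : W), residue R a • w = a • w := by
    intro a w
    rw [← algebraMap_smul (ResidueField R) a w]; rfl
  have hsmV : ∀ (a : R) (w : CotangentSpace R), residue R a • w = a • w := by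
    intro a w
    rw [← algebraMap_smul (ResidueField R) a w]; rfl
  let up : Submodule R W → Submodule (ResidueField R) W := fun N =>
    ⟨N.toAddSubmonoid, by
      intro c x hx
      obtain ⟨a, rfl⟩ := residue_surjective c
      rw [hsm]
      exact N.smul_mem a hx⟩
  have hup : ∀ N w, w ∈ up N ↔ w ∈ N := fun N w => Iff.rfl
  -- dimension of W
  obtain ⟨s, hsc, hs⟩ := mu_spec ((maximalIdeal R) ^ 2)
  have hsm2 : ∀ x : s, (x : R) ∈ (maximalIdeal R) ^ 2 := fun x => by
    rw [← hs]; exact Ideal.subset_span x.2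
  have htop : ⊤ ≤ Submodule.span (ResidueField R)
      (Set.range fun x : s => q ⟨x, hsm2 x⟩) := by
    intro w _
    obtain ⟨⟨z, hz⟩, rfl⟩ := hq w
    have hz' := hz
    rw [← hs] at hz'
    have key : ∀ z (hz' : z ∈ Ideal.span (s : Set R)), ∀ hz : z ∈ (maximalIdeal R) ^ 2,
        q ⟨z, hz⟩ ∈ Submodule.span (ResidueField R)
          (Set.range fun x : s => q ⟨x, hsm2 x⟩) := by
      intro z hz'
      induction hz' using Submodule.span_induction with
      | mem x hx => intro hz; exact Submodule.subset_span ⟨⟨x, hx⟩, rfl⟩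
      | zero =>
        intro hz
        have : q ⟨0, hz⟩ = 0 := map_zero q
        rw [this]; exact zero_mem _
      | add x y hx hy ihx ihy =>
        intro hz
        have : q ⟨x + y, hz⟩ = q ⟨x, hs ▸ hx⟩ + q ⟨y, hs ▸ hy⟩ := by
          rw [← map_add]; rfl
        rw [this]; exact add_mem (ihx _) (ihy _)
      | smul a x hx ih =>
        intro hz
        have : q ⟨a • x, hz⟩ = residue R a • q ⟨x, hs ▸ hx⟩ := by
          rw [hsm, ← map_smul]; rfl
        rw [this]; exact Submodule.smul_mem _ _ (ih _)
    exact key z hz' hz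
  have hfd : FiniteDimensional (ResidueField R) W :=
    ⟨⟨Finset.univ.image (fun x : s => q ⟨x, hsm2 x⟩), by simpa using top_le_iff.1 htop⟩⟩
  have hdim : finrank (ResidueField R) W < (r + 2).choose 2 := by
    refine lt_of_le_of_lt ?_ hd
    rw [← hsc]
    simpa using finrank_le_of_span_eq_top (top_le_iff.1 htop)
  -- bilinear map
  have hmm : ∀ x y : maximalIdeal R, (x * y : R) ∈ (maximalIdeal R) ^ 2 := fun x y => by
    rw [pow_two]; exact Ideal.mul_mem_mul x.2 y.2
  have hq0 : ∀ x (hx : x ∈ (maximalIdeal R) ^ 2), q ⟨x, hx⟩ = 0 ↔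
      x ∈ maximalIdeal R * (maximalIdeal R) ^ 2 := by
    intro x hx
    have hmap : (maximalIdeal R • (⊤ : Submodule R ↥((maximalIdeal R) ^ 2))).map
        ((maximalIdeal R) ^ 2).subtype = maximalIdeal R * (maximalIdeal R) ^ 2 := by
      rw [Submodule.map_smul'', Submodule.map_subtype_top, smul_eq_mul]
    rw [← LinearMap.mem_ker, hker, ← hmap]
    constructor
    · intro h
      exact ⟨_, h, rfl⟩
    · rintro ⟨x', h, rfl⟩
      exact h
  let B0 : CotangentSpace R → CotangentSpace R → W := fun v w =>
    q ⟨_, hmm (Function.surjInv (maximalIdeal R).toCotangent_surjective v)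
      (Function.surjInv (maximalIdeal R).toCotangent_surjective w)⟩
  have hB0 : ∀ x y : maximalIdeal R, B0 ((maximalIdeal R).toCotangent x)
      ((maximalIdeal R).toCotangent y) = q ⟨_, hmm x y⟩ := by
    intro x y
    simp only [B0]
    generalize hx' : Function.surjInv (maximalIdeal R).toCotangent_surjective
      ((maximalIdeal R).toCotangent x) = x'
    generalize hy' : Function.surjInv (maximalIdeal R).toCotangent_surjective
      ((maximalIdeal R).toCotangent y) = y'
    have ex : (maximalIdeal R).toCotangent x' = (maximalIdeal R).toCotangent x := by
      rw [← hx']; exact Function.surjInv_eq _ _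
    have ey : (maximalIdeal R).toCotangent y' = (maximalIdeal R).toCotangent y := by
      rw [← hy']; exact Function.surjInv_eq _ _
    rw [Ideal.toCotangent_eq] at ex ey
    rw [← sub_eq_zero, ← map_sub]
    refine (hq0 (x' * y' - x * y) (sub_mem (hmm _ _) (hmm _ _))).2 ?_
    have : (x' * y' - x * y : R) = y' * (x' - x) + x * (y' - y) := by ring
    rw [this]
    exact add_mem (Ideal.mul_mem_mul y'.2 ex) (Ideal.mul_mem_mul x.2 ey)
  have hsurj := (maximalIdeal R).toCotangent_surjective
  let B : CotangentSpace R →ₗ[ResidueField R] CotangentSpace R →ₗ[ResidueField R] W :=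
    LinearMap.mk₂ (ResidueField R) B0
      (by
        intro v v' w
        obtain ⟨x, rfl⟩ := hsurj v
        obtain ⟨x', rfl⟩ := hsurj v'
        obtain ⟨y, rfl⟩ := hsurj w
        rw [← map_add, hB0, hB0, hB0, ← map_add]
        congr 1; ext; simp [add_mul])
      (by
        intro c v w
        obtain ⟨x, rfl⟩ := hsurj v
        obtain ⟨y, rfl⟩ := hsurj w
        obtain ⟨a, rfl⟩ := residue_surjective c
        rw [hsmV, hsm, ← map_smul, hB0, hB0, ← map_smul]
        congr 1; ext; simp [mul_assoc])
      (by
        intro v w w'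
        obtain ⟨x, rfl⟩ := hsurj v
        obtain ⟨x', rfl⟩ := hsurj w'
        obtain ⟨y, rfl⟩ := hsurj w
        rw [← map_add, hB0, hB0, hB0, ← map_add]
        congr 1; ext; simp [mul_add])
      (by
        intro c v w
        obtain ⟨x, rfl⟩ := hsurj v
        obtain ⟨y, rfl⟩ := hsurj w
        obtain ⟨a, rfl⟩ := residue_surjective c
        rw [hsmV, hsm, ← map_smul, hB0, hB0, ← map_smul]
        congr 1; ext; simp [mul_left_comm])
  have hBB : ∀ x y : maximalIdeal R, B ((maximalIdeal R).toCotangent x)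
      ((maximalIdeal R).toCotangent y) = q ⟨_, hmm x y⟩ := hB0
  have hsymm : ∀ v w, B v w = B w v := by
    intro v w
    obtain ⟨x, rfl⟩ := hsurj v
    obtain ⟨y, rfl⟩ := hsurj w
    rw [hBB, hBB]
    congr 1; ext; simp [mul_comm]
  have hBtop : Submodule.map₂ B ⊤ ⊤ = ⊤ := by
    rw [eq_top_iff]
    intro w _
    obtain ⟨⟨z, hz⟩, rfl⟩ := hq w
    have hz' := hz
    rw [pow_two] at hz'
    have key : ∀ z (hz' : z ∈ maximalIdeal R * maximalIdeal R),
        ∀ hz : z ∈ (maximalIdeal R) ^ 2, q ⟨z, hz⟩ ∈ Submodule.map₂ B ⊤ ⊤ := by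
      intro z hz'
      induction hz' using Submodule.mul_induction_on' with
      | mem_mul_mem x hx y hy =>
        intro hz
        have := hBB ⟨x, hx⟩ ⟨y, hy⟩
        rw [← this]
        exact Submodule.apply_mem_map₂ _ trivial trivial
      | add x hx y hy ihx ihy =>
        intro hz
        have : q ⟨x + y, hz⟩ = q ⟨x, pow_two (maximalIdeal R) ▸ hx⟩
            + q ⟨y, pow_two (maximalIdeal R) ▸ hy⟩ := by
          rw [← map_add]; rfl
        rw [this]; exact add_mem (ihx _) (ihy _)
    exact key z hz' hz
  obtain ⟨U, hU, hU2⟩ := es_main r B hsymm hBtop hdim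
  let u := finBasis (ResidueField R) U
  choose y hy using fun i => hsurj (u i : CotangentSpace R)
  let S : Finset R := Finset.univ.image fun i => (y i : R)
  have hSm : Ideal.span (S : Set R) ≤ maximalIdeal R := by
    rw [Ideal.span_le]
    intro x hx
    simp only [S, Finset.coe_image, Finset.coe_univ, Set.image_univ, Set.mem_range] at hx
    obtain ⟨i, rfl⟩ := hx
    exact (y i).2
  refine ⟨Ideal.span (S : Set R), ?_, hSm, ?_⟩
  swap
  · refine (mu_le_card S).trans (Finset.card_image_le.trans ?_)
    simpa using hU
  refine Submodule.le_of_le_smul_of_le_jacobson_bot (I := maximalIdeal R)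
    (IsNoetherian.noetherian _) (IsLocalRing.maximalIdeal_le_jacobson _) ?_
  let Q : Submodule R ↥((maximalIdeal R) ^ 2) :=
    Submodule.comap ((maximalIdeal R) ^ 2).subtype
      (Ideal.span (S : Set R) ⊔ maximalIdeal R • (maximalIdeal R) ^ 2)
  have hQ : ⊤ ≤ up (Q.map q) := by
    rw [← hU2, Submodule.map₂_le]
    intro v hv w _
    obtain ⟨z, rfl⟩ := hsurj w
    have e := congrArg Subtype.val (u.sum_repr ⟨v, hv⟩)
    simp only [Submodule.coe_sum, Submodule.coe_smul] at e
    rw [← e, map_sum, LinearMap.sum_apply]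
    refine Submodule.sum_mem _ fun i _ => ?_
    rw [map_smul, LinearMap.smul_apply]
    refine Submodule.smul_mem _ _ ?_
    rw [← hy i, hBB, hup]
    refine ⟨_, ?_, rfl⟩
    change (y i * z : R) ∈ Ideal.span (S : Set R) ⊔ maximalIdeal R • (maximalIdeal R) ^ 2
    refine Submodule.mem_sup_left ?_
    refine Ideal.mul_mem_right _ _ (Ideal.subset_span ?_)
    simp [S]
  intro z hz
  obtain ⟨z', hz', e⟩ := (hup _ _).1 (hQ (show q ⟨z, hz⟩ ∈ ⊤ from trivial))
  have e2 : q (⟨z, hz⟩ - z') = 0 := by rw [map_sub, e, sub_self]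
  have e3 := (hq0 (z - z') (sub_mem hz z'.2)).1 e2
  have e4 : z = z' + (z - z') := by ring
  rw [e4]
  exact add_mem hz' (Submodule.mem_sup_right e3)

theorem es_ms {R : Type*} [CommRing R] [IsLocalRing R] [IsNoetherianRing R]
    [Infinite (ResidueField R)] (r : ℕ)
    (hd : mu ((maximalIdeal R) ^ 2) < (r + 2).choose 2) : ms R ≤ r := by
  let i1 : Module (ResidueField R) (↥((maximalIdeal R) ^ 2) ⧸
      maximalIdeal R • (⊤ : Submodule R ↥((maximalIdeal R) ^ 2))) :=
    inferInstanceAs (Module (R ⧸ maximalIdeal R) _)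
  let i2 : IsScalarTower R (ResidueField R) (↥((maximalIdeal R) ^ 2) ⧸
      maximalIdeal R • (⊤ : Submodule R ↥((maximalIdeal R) ^ 2))) :=
    inferInstanceAs (IsScalarTower R (R ⧸ maximalIdeal R) _)
  obtain ⟨I, h1, h2, h3⟩ := es_alg (Submodule.mkQ
    (maximalIdeal R • (⊤ : Submodule R ↥((maximalIdeal R) ^ 2))))
    (Submodule.mkQ_surjective _) (Submodule.ker_mkQ _) r hd
  exact (Nat.sInf_le ⟨I, h1, h2, rfl⟩ : ms R ≤ mu I).trans h3

end ES

/-- Let `(R, m, k)` be a Noetherian local ring with infinite residue field and `m² ≠ 0`,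
and let `r ≥ 1`.  If `μ(m²) < (r+2 choose 2)`, then `ms(R) ≤ r`; in particular, if
`μ(m²) ≤ 2`, then `ms(R) = 1`. -/
theorem stmt13 {R : Type*} [CommRing R] [IsLocalRing R] [IsNoetherianRing R]
    [Infinite (ResidueField R)]
    (hm2 : (maximalIdeal R) ^ 2 ≠ ⊥) (r : ℕ) (hr : 1 ≤ r) :
    (mu ((maximalIdeal R) ^ 2) < (r + 2).choose 2 → ms R ≤ r) ∧
    (mu ((maximalIdeal R) ^ 2) ≤ 2 → ms R = 1) := by
  refine ⟨es_ms r, fun h => le_antisymm (es_ms 1 (lt_of_le_of_lt h (by decide))) ?_⟩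
  have hne : {n : ℕ | ∃ I : Ideal R,
    (maximalIdeal R) ^ 2 ≤ I ∧ I ≤ maximalIdeal R ∧ mu I = n}.Nonempty :=
    ⟨_, maximalIdeal R, Ideal.pow_le_self two_ne_zero, le_rfl, rfl⟩
  obtain ⟨I, h1, h2, h3⟩ := Nat.sInf_mem hne
  change mu I = ms R at h3
  rw [← h3, Nat.one_le_iff_ne_zero]
  intro h0
  obtain ⟨s, hs, hI⟩ := mu_spec I
  rw [h0, Finset.card_eq_zero] at hs
  subst hs
  apply hm2
  rw [eq_bot_iff]
  refine h1.trans ?_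
  rw [← hI]; simp
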